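/- Fix k ≥ 2 and let τ consist of a single binary relation symbol. Let θ be the first-order sentence ∀x₁…∀x_{k+1} ⋁_{1≤i<j≤k+1} x_i = x_j, and for a D(τ)-sentence φ let ψ be the D(τ)-formula (θ ∨ φ) ∨ ⋁_{i=1}^{k} dep(x), a formula with single free variable x, where dep(x) is the constancy atom. Then φ is true in every τ-structure of cardinality greater than k if and only if ψ is k-coherent. -/

import Mathlib

/-! Core definitions: team semantics for dependence logic over a relational vocabulary. -/

/-- A structure for a relational vocabulary: `σ` is the type of relation symbols,
`ar` gives their arities, `A` is the universe. -/
structure DepStr (σ : Type) (ar : σ → ℕ) (A : Type) where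
  rel : ∀ r : σ, (Fin (ar r) → A) → Prop

/-- Formulas of dependence logic (in negation normal form), with free variables
of type `V`; quantifiers extend the variable type by one fresh variable (`Option`). -/
inductive DepFormula (σ : Type) (ar : σ → ℕ) : Type → Type 1 where
  | rel {V : Type} (r : σ) (ts : Fin (ar r) → V) : DepFormula σ ar V
  | nrel {V : Type} (r : σ) (ts : Fin (ar r) → V) : DepFormula σ ar V
  | eq {V : Type} (x y : V) : DepFormula σ ar V
  | neq {V : Type} (x y : V) : DepFormula σ ar V
  | dep {V : Type} (m : ℕ) (ys : Fin m → V) (z : V) : DepFormula σ ar V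
  | and {V : Type} (φ ψ : DepFormula σ ar V) : DepFormula σ ar V
  | or {V : Type} (φ ψ : DepFormula σ ar V) : DepFormula σ ar V
  | all {V : Type} (φ : DepFormula σ ar (Option V)) : DepFormula σ ar V
  | ex {V : Type} (φ : DepFormula σ ar (Option V)) : DepFormula σ ar V

/-- Team semantics: `DepSat M V φ T` says that the team `T` (a set of assignments
`V → A`) satisfies `φ` in the structure `M`. -/
def DepSat {σ : Type} {ar : σ → ℕ} {A : Type} (M : DepStr σ ar A) :
    (V : Type) → DepFormula σ ar V → Set (V → A) → Prop
  | _, .rel r ts, T => ∀ s ∈ T, M.rel r fun i => s (ts i)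
  | _, .nrel r ts, T => ∀ s ∈ T, ¬ M.rel r fun i => s (ts i)
  | _, .eq x y, T => ∀ s ∈ T, s x = s y
  | _, .neq x y, T => ∀ s ∈ T, s x ≠ s y
  | _, .dep _ ys z, T => ∀ s₁ ∈ T, ∀ s₂ ∈ T, (∀ i, s₁ (ys i) = s₂ (ys i)) → s₁ z = s₂ z
  | V, .and φ ψ, T => DepSat M V φ T ∧ DepSat M V ψ T
  | V, .or φ ψ, T => ∃ T₁ T₂, T = T₁ ∪ T₂ ∧ DepSat M V φ T₁ ∧ DepSat M V ψ T₂
  | V, .all φ, T => DepSat M (Option V) φ {s | (fun v => s (some v)) ∈ T}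
  | V, .ex φ, T => ∃ f : (V → A) → A,
      DepSat M (Option V) φ {s | ∃ t ∈ T, s = fun o => Option.elim o (f t) t}

/-- The `∃`-free (universal) fragment `∀D`. -/
def DepFormula.noEx {σ : Type} {ar : σ → ℕ} : (V : Type) → DepFormula σ ar V → Prop
  | _, .ex _ => False
  | V, .all φ => DepFormula.noEx (Option V) φ
  | V, .and φ ψ => DepFormula.noEx V φ ∧ DepFormula.noEx V ψ
  | V, .or φ ψ => DepFormula.noEx V φ ∧ DepFormula.noEx V ψ
  | _, _ => True

/-- The quantifier-free fragment `DQF`. -/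
def DepFormula.isQF {σ : Type} {ar : σ → ℕ} : (V : Type) → DepFormula σ ar V → Prop
  | _, .ex _ => False
  | _, .all _ => False
  | V, .and φ ψ => DepFormula.isQF V φ ∧ DepFormula.isQF V ψ
  | V, .or φ ψ => DepFormula.isQF V φ ∧ DepFormula.isQF V ψ
  | _, _ => True

/-- The dependence-atom-free (first-order) fragment. -/
def DepFormula.noDep {σ : Type} {ar : σ → ℕ} : (V : Type) → DepFormula σ ar V → Prop
  | _, .dep _ _ _ => False
  | V, .and φ ψ => DepFormula.noDep V φ ∧ DepFormula.noDep V ψ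
  | V, .or φ ψ => DepFormula.noDep V φ ∧ DepFormula.noDep V ψ
  | V, .all φ => DepFormula.noDep (Option V) φ
  | V, .ex φ => DepFormula.noDep (Option V) φ
  | _, _ => True

/-- Induced substructure on a subset `B` of the universe (relational vocabulary). -/
def DepStr.sub {σ : Type} {ar : σ → ℕ} {A : Type} (M : DepStr σ ar A) (B : Set A) :
    DepStr σ ar B :=
  ⟨fun r v => M.rel r fun i => (v i : A)⟩

/-- Restriction `T ↾ B` of a team to assignments taking values in `B`. -/
def teamRestrict {V A : Type} (T : Set (V → A)) (B : Set A) : Set (V → B) :=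
  {t | (fun v => (t v : A)) ∈ T}


/-- First-order formulas over a relational vocabulary. -/
inductive FOForm (σ : Type) (ar : σ → ℕ) : Type → Type 1 where
  | rel {V : Type} (r : σ) (ts : Fin (ar r) → V) : FOForm σ ar V
  | eq {V : Type} (x y : V) : FOForm σ ar V
  | not {V : Type} (φ : FOForm σ ar V) : FOForm σ ar V
  | and {V : Type} (φ ψ : FOForm σ ar V) : FOForm σ ar V
  | or {V : Type} (φ ψ : FOForm σ ar V) : FOForm σ ar V
  | all {V : Type} (φ : FOForm σ ar (Option V)) : FOForm σ ar V
  | ex {V : Type} (φ : FOForm σ ar (Option V)) : FOForm σ ar V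

/-- Tarskian satisfaction of a first-order formula by a single assignment. -/
def FOSat {σ : Type} {ar : σ → ℕ} {A : Type} (M : DepStr σ ar A) :
    (V : Type) → FOForm σ ar V → (V → A) → Prop
  | _, .rel r ts, s => M.rel r fun i => s (ts i)
  | _, .eq x y, s => s x = s y
  | V, .not φ, s => ¬ FOSat M V φ s
  | V, .and φ ψ, s => FOSat M V φ s ∧ FOSat M V ψ s
  | V, .or φ ψ, s => FOSat M V φ s ∨ FOSat M V ψ s
  | V, .all φ, s => ∀ a : A, FOSat M (Option V) φ (fun o => Option.elim o a s)
  | V, .ex φ, s => ∃ a : A, FOSat M (Option V) φ (fun o => Option.elim o a s)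

/-- A first-order sentence (no free variables) is true in `M`. -/
def FOTrue {σ : Type} {ar : σ → ℕ} {A : Type} (M : DepStr σ ar A)
    (φ : FOForm σ ar Empty) : Prop :=
  FOSat M Empty φ (fun e => e.elim)

/-- Quantifier-free first-order formulas. -/
def FOForm.isQF {σ : Type} {ar : σ → ℕ} : (V : Type) → FOForm σ ar V → Prop
  | _, .all _ => False
  | _, .ex _ => False
  | V, .not φ => FOForm.isQF V φ
  | V, .and φ ψ => FOForm.isQF V φ ∧ FOForm.isQF V ψ
  | V, .or φ ψ => FOForm.isQF V φ ∧ FOForm.isQF V ψ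
  | _, _ => True

/-- Universal first-order formulas: a block of `∀` followed by a quantifier-free formula. -/
inductive FOForm.IsUniversal {σ : Type} {ar : σ → ℕ} : {V : Type} → FOForm σ ar V → Prop
  | of_qf {V : Type} (φ : FOForm σ ar V) : FOForm.isQF V φ → FOForm.IsUniversal φ
  | all {V : Type} (φ : FOForm σ ar (Option V)) :
      FOForm.IsUniversal φ → FOForm.IsUniversal (.all φ)

/-- `OptIter l V` adds `l` fresh variables to the variable type `V`. -/
def OptIter : ℕ → Type → Type
  | 0, V => V
  | l+1, V => Option (OptIter l V)

/-- The embedding of the old variables into `OptIter l V`. -/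
def optEmbed : (l : ℕ) → {V : Type} → V → OptIter l V
  | 0, _, v => v
  | l+1, _, v => some (optEmbed l v)

/-- Prefix a first-order formula with `l` universal quantifiers. -/
def FOForm.allIter {σ : Type} {ar : σ → ℕ} :
    (l : ℕ) → {V : Type} → FOForm σ ar (OptIter l V) → FOForm σ ar V
  | 0, _, φ => φ
  | l+1, _, φ => FOForm.allIter l (.all φ)

/-- Prefix a dependence formula with `l` universal quantifiers. -/
def DepFormula.allIter {σ : Type} {ar : σ → ℕ} :
    (l : ℕ) → {V : Type} → DepFormula σ ar (OptIter l V) → DepFormula σ ar V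
  | 0, _, φ => φ
  | l+1, _, φ => DepFormula.allIter l (.all φ)

/-- The iterated duplicate team `T⟨y⃗ ↦ A⟩`: all extensions of members of `T`
to the `l` new variables. -/
def dupIter {A : Type} (l : ℕ) {V : Type} (T : Set (V → A)) : Set (OptIter l V → A) :=
  {s | (fun v => s (optEmbed l v)) ∈ T}

/-- The vocabulary `τ ∪ {R}` with `R` a fresh `n`-ary relation symbol. -/
def exAr {σ : Type} (ar : σ → ℕ) (n : ℕ) : σ ⊕ Unit → ℕ :=
  Sum.elim ar fun _ => n

/-- The expansion `(A, Rel(T))` of a structure by a team, interpreting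
the fresh symbol `R` as the `n`-ary relation determined by the team `T`. -/
def expandR {σ : Type} {ar : σ → ℕ} {A : Type} {n : ℕ}
    (M : DepStr σ ar A) (T : Set (Fin n → A)) : DepStr (σ ⊕ Unit) (exAr ar n) A :=
  ⟨fun r => match r with
    | .inl r => M.rel r
    | .inr _ => fun v => v ∈ T⟩

/-- `ψ` rewrites the dependence formula `φ(x₁,…,xₙ)`:  `A ⊨_T φ  ↔  (A, Rel(T)) ⊨ ψ`. -/
def Rewrites {σ : Type} {ar : σ → ℕ} {n : ℕ}
    (ψ : FOForm (σ ⊕ Unit) (exAr ar n) Empty) (φ : DepFormula σ ar (Fin n)) : Prop :=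
  ∀ (A : Type) [Nonempty A] (M : DepStr σ ar A) (T : Set (Fin n → A)),
    DepSat M (Fin n) φ T ↔ FOTrue (expandR M T) ψ

/-- `φ` is first-order rewritable. -/
def FORewritable {σ : Type} {ar : σ → ℕ} {n : ℕ} (φ : DepFormula σ ar (Fin n)) : Prop :=
  ∃ ψ : FOForm (σ ⊕ Unit) (exAr ar n) Empty, Rewrites ψ φ

/-- `φ` is rewritable to a universal first-order sentence. -/
def UnivRewritable {σ : Type} {ar : σ → ℕ} {n : ℕ} (φ : DepFormula σ ar (Fin n)) : Prop :=
  ∃ ψ : FOForm (σ ⊕ Unit) (exAr ar n) Empty, ψ.IsUniversal ∧ Rewrites ψ φ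

/-- `φ` is `k`-coherent: a team satisfies `φ` iff all its subteams with at
most `k` elements do. -/
def KCoherent {σ : Type} {ar : σ → ℕ} {V : Type} (k : ℕ) (φ : DepFormula σ ar V) : Prop :=
  ∀ (A : Type) [Nonempty A] (M : DepStr σ ar A) (T : Set (V → A)),
    DepSat M V φ T ↔ ∀ S ⊆ T, S.Finite → S.ncard ≤ k → DepSat M V φ S

/-- `φ` is coherent: `k`-coherent for some `k ≥ 1`. -/
def Coherent {σ : Type} {ar : σ → ℕ} {V : Type} (φ : DepFormula σ ar V) : Prop :=
  ∃ k : ℕ, 1 ≤ k ∧ KCoherent k φ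

/-- `φ` is `k`-coherent in the finite. -/
def KCoherentFin {σ : Type} {ar : σ → ℕ} {V : Type} (k : ℕ) (φ : DepFormula σ ar V) : Prop :=
  ∀ (A : Type) [Nonempty A] [Finite A] (M : DepStr σ ar A) (T : Set (V → A)),
    DepSat M V φ T ↔ ∀ S ⊆ T, S.Finite → S.ncard ≤ k → DepSat M V φ S

/-- Strong `k`-coherence of `∀y₁…∀y_l β` (with `β` quantifier-free): a team `T`
satisfies `∀y⃗ β` iff every at-most-`k`-element subteam of the duplicated team
`T⟨y⃗ ↦ A⟩` satisfies `β`. -/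
def StronglyKCoherent {σ : Type} {ar : σ → ℕ} (k : ℕ) (n l : ℕ)
    (β : DepFormula σ ar (OptIter l (Fin n))) : Prop :=
  ∀ (A : Type) [Nonempty A] (M : DepStr σ ar A) (T : Set (Fin n → A)),
    DepSat M (Fin n) (DepFormula.allIter l β) T ↔
      ∀ S ⊆ dupIter l T, S.Finite → S.ncard ≤ k → DepSat M (OptIter l (Fin n)) β S

/-- Strong `k`-coherence in the finite. -/
def StronglyKCoherentFin {σ : Type} {ar : σ → ℕ} (k : ℕ) (n l : ℕ)
    (β : DepFormula σ ar (OptIter l (Fin n))) : Prop :=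
  ∀ (A : Type) [Nonempty A] [Finite A] (M : DepStr σ ar A) (T : Set (Fin n → A)),
    DepSat M (Fin n) (DepFormula.allIter l β) T ↔
      ∀ S ⊆ dupIter l T, S.Finite → S.ncard ≤ k → DepSat M (OptIter l (Fin n)) β S

/-- The `i`-th of the `l` fresh variables in `OptIter l V`. -/
def newVar : (l : ℕ) → {V : Type} → Fin l → OptIter l V
  | 0, _, i => i.elim0
  | l+1, V, i =>
      Fin.lastCases (motive := fun _ => OptIter (l+1) V)
        (none : Option (OptIter l V))
        (fun j => (some (newVar l j) : Option (OptIter l V))) i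

/-- Disjunction of a nonempty list of formulas (with a default for the empty list). -/
def orListD {σ : Type} {ar : σ → ℕ} {V : Type} (default : DepFormula σ ar V) :
    List (DepFormula σ ar V) → DepFormula σ ar V
  | [] => default
  | [ψ] => ψ
  | ψ :: l => .or ψ (orListD default l)

/-- Renaming of variables in a dependence formula. -/
def DepFormula.rename {σ : Type} {ar : σ → ℕ} :
    {V W : Type} → (V → W) → DepFormula σ ar V → DepFormula σ ar W
  | _, _, f, .rel r ts => .rel r fun i => f (ts i)
  | _, _, f, .nrel r ts => .nrel r fun i => f (ts i)
  | _, _, f, .eq x y => .eq (f x) (f y)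
  | _, _, f, .neq x y => .neq (f x) (f y)
  | _, _, f, .dep m ys z => .dep m (fun i => f (ys i)) (f z)
  | _, _, f, .and φ ψ => .and (DepFormula.rename f φ) (DepFormula.rename f ψ)
  | _, _, f, .or φ ψ => .or (DepFormula.rename f φ) (DepFormula.rename f ψ)
  | _, _, f, .all φ => .all (DepFormula.rename (Option.map f) φ)
  | _, _, f, .ex φ => .ex (DepFormula.rename (Option.map f) φ)

/-- A dependence-logic sentence is true in `M`: it is satisfied by the team
consisting of the empty assignment. -/
def DTrueIn {σ : Type} {ar : σ → ℕ} {A : Type} (M : DepStr σ ar A)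
    (φ : DepFormula σ ar Empty) : Prop :=
  DepSat M Empty φ {fun e => e.elim}

/-- The first-order sentence `∀x₁…∀x_{k+1} ⋁_{1 ≤ i < j ≤ k+1} xᵢ = xⱼ`
("there are at most `k` elements"), written as a dependence formula with the
single free variable `x` (not occurring in it). -/
def atMostK {σ : Type} (ar : σ → ℕ) (k : ℕ) : DepFormula σ ar (Fin 1) :=
  DepFormula.allIter (k+1)
    (orListD (.eq (optEmbed (k+1) (0 : Fin 1)) (optEmbed (k+1) (0 : Fin 1)))
      ((((List.finRange (k+1)).product (List.finRange (k+1))).filter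
          (fun p => p.1 < p.2)).map
        (fun p => .eq (newVar (k+1) p.1) (newVar (k+1) p.2))))

/-- The constancy atom `dep(x)`. -/
def depx {σ : Type} (ar : σ → ℕ) : DepFormula σ ar (Fin 1) :=
  .dep 0 (fun i => i.elim0) (0 : Fin 1)

/-- The disjunction `⋁_{i=1}^{k} dep(x)` of `k` copies of the constancy atom. -/
def depxOr {σ : Type} (ar : σ → ℕ) (k : ℕ) : DepFormula σ ar (Fin 1) :=
  orListD (depx ar) (List.replicate k (depx ar))

/-- The formula `ψ = (θ ∨ φ) ∨ ⋁_{i=1}^{k} dep(x)`. -/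
def psi12 {σ : Type} (ar : σ → ℕ) (k : ℕ) (φ : DepFormula σ ar Empty) :
    DepFormula σ ar (Fin 1) :=
  .or (.or (atMostK ar k) (φ.rename (fun e => e.elim))) (depxOr ar k)

theorem depSat_mono {σ : Type} {ar : σ → ℕ} {A : Type} (M : DepStr σ ar A) {V : Type}
    (φ : DepFormula σ ar V) : ∀ (S T : Set (V → A)), S ⊆ T → DepSat M V φ T → DepSat M V φ S := by
  induction φ with
  | rel r ts => intro S T h hT s hs; exact hT s (h hs)
  | nrel r ts => intro S T h hT s hs; exact hT s (h hs)
  | eq x y => intro S T h hT s hs; exact hT s (h hs)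
  | neq x y => intro S T h hT s hs; exact hT s (h hs)
  | dep m ys z => intro S T h hT s hs t ht; exact hT s (h hs) t (h ht)
  | and φ ψ ih1 ih2 =>
    intro S T h hT
    exact ⟨ih1 S T h hT.1, ih2 S T h hT.2⟩
  | or φ ψ ih1 ih2 =>
    rintro S T h ⟨T1, T2, rfl, h1, h2⟩
    refine ⟨S ∩ T1, S ∩ T2, ?_, ih1 _ _ Set.inter_subset_right h1,
      ih2 _ _ Set.inter_subset_right h2⟩
    rw [← Set.inter_union_distrib_left, Set.inter_eq_left.2 h]
  | all φ ih =>
    intro S T h hT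
    exact ih _ _ (fun s hs => h hs) hT
  | ex φ ih =>
    rintro S T h ⟨f, hf⟩
    exact ⟨f, ih _ _ (by
      rintro s ⟨t, ht, e⟩
      exact ⟨t, h ht, e⟩) hf⟩

theorem depSat_empty {σ : Type} {ar : σ → ℕ} {A : Type} [Nonempty A] (M : DepStr σ ar A) {V : Type}
    (φ : DepFormula σ ar V) : DepSat M V φ ∅ := by
  induction φ with
  | rel r ts => intro s hs; exact hs.elim
  | nrel r ts => intro s hs; exact hs.elim
  | eq x y => intro s hs; exact hs.elim
  | neq x y => intro s hs; exact hs.elim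
  | dep m ys z => intro s hs; exact hs.elim
  | and φ ψ ih1 ih2 => exact ⟨ih1, ih2⟩
  | or φ ψ ih1 ih2 => exact ⟨∅, ∅, by simp, ih1, ih2⟩
  | all φ ih => exact ih
  | ex φ ih =>
    exact ⟨fun _ => Classical.arbitrary A, depSat_mono M φ _ _ (by
      rintro s ⟨t, ht, e⟩
      exact ht.elim) ih⟩

theorem depSat_rename {σ : Type} {ar : σ → ℕ} {A : Type} [Nonempty A] (M : DepStr σ ar A) {V : Type}
    (φ : DepFormula σ ar V) : ∀ {W : Type} (f : V → W) (T : Set (W → A)),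
      DepSat M W (φ.rename f) T ↔ DepSat M V φ ((fun s => s ∘ f) '' T) := by
  induction φ with
  | rel r ts => intro W f T; simp [DepSat, DepFormula.rename]
  | nrel r ts => intro W f T; simp [DepSat, DepFormula.rename]
  | eq x y => intro W f T; simp [DepSat, DepFormula.rename]
  | neq x y => intro W f T; simp [DepSat, DepFormula.rename]
  | dep m ys z => intro W f T; simp [DepSat, DepFormula.rename]
  | and φ ψ ih1 ih2 => intro W f T; simp [DepSat, DepFormula.rename, ih1, ih2]
  | or φ ψ ih1 ih2 =>
    intro W f T
    simp only [DepSat, DepFormula.rename, ih1, ih2]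
    constructor
    · rintro ⟨T1, T2, rfl, h1, h2⟩
      exact ⟨_, _, Set.image_union _ _ _, h1, h2⟩
    · rintro ⟨T1, T2, e, h1, h2⟩
      refine ⟨{s ∈ T | s ∘ f ∈ T1}, {s ∈ T | s ∘ f ∈ T2}, ?_, ?_, ?_⟩
      · ext s
        constructor
        · intro hs
          have : s ∘ f ∈ T1 ∪ T2 := e ▸ ⟨s, hs, rfl⟩
          rcases this with h | h
          · exact Or.inl ⟨hs, h⟩
          · exact Or.inr ⟨hs, h⟩
        · rintro (h | h)
          · exact h.1
          · exact h.1
      · refine depSat_mono M _ _ _ ?_ h1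
        rintro _ ⟨s, hs, rfl⟩
        exact hs.2
      · refine depSat_mono M _ _ _ ?_ h2
        rintro _ ⟨s, hs, rfl⟩
        exact hs.2
  | all φ ih =>
    intro W f T
    simp only [DepSat, DepFormula.rename, ih]
    refine iff_of_eq (congrArg _ ?_)
    ext s
    constructor
    · rintro ⟨s, hs, rfl⟩
      exact ⟨_, hs, rfl⟩
    · rintro ⟨t, ht, e⟩
      refine ⟨fun o => Option.elim o (s none) t, ht, ?_⟩
      funext o
      cases o with
      | none => rfl
      | some v => exact congrFun e v
  | ex φ ih =>
    intro W f T
    simp only [DepSat, DepFormula.rename, ih]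
    constructor
    · rintro ⟨g, hg⟩
      classical
      refine ⟨fun s => if h : ∃ t ∈ T, t ∘ f = s then g h.choose else Classical.arbitrary A, ?_⟩
      refine depSat_mono M _ _ _ ?_ hg
      rintro _ ⟨s, hs, rfl⟩
      have h : ∃ t ∈ T, t ∘ f = s := hs
      refine ⟨_, ⟨h.choose, h.choose_spec.1, rfl⟩, ?_⟩
      funext o
      cases o with
      | none => simp [h]
      | some v => exact congrFun h.choose_spec.2 v
    · rintro ⟨g, hg⟩
      refine ⟨fun t => g (t ∘ f), ?_⟩
      refine depSat_mono M _ _ _ ?_ hg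
      rintro _ ⟨_, ⟨t, ht, rfl⟩, rfl⟩
      refine ⟨t ∘ f, ⟨t, ht, rfl⟩, ?_⟩
      funext o
      cases o <;> rfl

theorem depSat_sentence {σ : Type} {ar : σ → ℕ} {A : Type} [Nonempty A] (M : DepStr σ ar A)
    (φ : DepFormula σ ar Empty) (T : Set (Fin 1 → A)) :
    DepSat M (Fin 1) (φ.rename (fun e => e.elim)) T ↔ T = ∅ ∨ DTrueIn M φ := by
  rw [depSat_rename]
  rcases T.eq_empty_or_nonempty with rfl | hT
  · simp [depSat_empty]
  · have : (fun s : Fin 1 → A => s ∘ (fun e : Empty => (e.elim : Fin 1))) '' T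
        = {fun e => e.elim} := by
      obtain ⟨t, ht⟩ := hT
      ext s
      constructor
      · intro _
        exact funext fun e => e.elim
      · intro _
        exact ⟨t, ht, funext fun e => e.elim⟩
    rw [this]
    simp [DTrueIn, hT.ne_empty]

theorem depSat_allIter {σ : Type} {ar : σ → ℕ} {A : Type} (M : DepStr σ ar A) (l : ℕ) {V : Type}
    (T : Set (V → A)) : ∀ (φ : DepFormula σ ar (OptIter l V)),
      DepSat M V (DepFormula.allIter l φ) T ↔ DepSat M (OptIter l V) φ (dupIter l T) := by
  induction l with
  | zero => intro φ; exact Iff.rfl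
  | succ l ih => intro φ; exact ih (.all φ)

theorem exists_ext {A V : Type} (l : ℕ) (t : V → A) : ∀ g : Fin l → A,
    ∃ s : OptIter l V → A, (fun v => s (optEmbed l v)) = t ∧ ∀ i, s (newVar l i) = g i := by
  induction l with
  | zero => intro g; exact ⟨t, rfl, fun i => i.elim0⟩
  | succ l ih =>
    intro g
    obtain ⟨s, h1, h2⟩ := ih (fun i => g i.castSucc)
    refine ⟨fun o => Option.elim o (g (Fin.last l)) s, h1, fun i => ?_⟩
    induction i using Fin.lastCases with
    | last =>
      have e : (newVar (l+1) (Fin.last l) : OptIter (l+1) V) = (none : Option (OptIter l V)) := by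
        rw [newVar]
        exact Fin.lastCases_last
      rw [e]
      rfl
    | cast j =>
      have e : (newVar (l+1) j.castSucc : OptIter (l+1) V)
          = (some (newVar l j) : Option (OptIter l V)) := by
        rw [newVar]
        exact Fin.lastCases_castSucc _
      rw [e]
      exact h2 j

theorem depSat_orEq {σ : Type} {ar : σ → ℕ} {A V ι : Type} (M : DepStr σ ar A)
    (d : DepFormula σ ar V) (a b : ι → V) : ∀ (L : List ι), L ≠ [] → ∀ T : Set (V → A),
      (DepSat M V (orListD d (L.map fun p => .eq (a p) (b p))) T ↔
        ∀ s ∈ T, ∃ p ∈ L, s (a p) = s (b p)) := by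
  intro L
  induction L with
  | nil => intro h; exact absurd rfl h
  | cons p L ih =>
    intro _ T
    cases L with
    | nil => simp [orListD, DepSat]
    | cons q L =>
      have ih := ih (by simp)
      simp only [List.map_cons, orListD, DepSat] at ih ⊢
      simp only [ih]
      constructor
      · rintro ⟨T1, T2, rfl, h1, h2⟩ s (hs | hs)
        · exact ⟨p, by simp, h1 s hs⟩
        · obtain ⟨r, hr, e⟩ := h2 s hs
          exact ⟨r, List.mem_cons_of_mem _ hr, e⟩
      · intro h
        refine ⟨{s ∈ T | s (a p) = s (b p)}, {s ∈ T | ∃ r ∈ q :: L, s (a r) = s (b r)}, ?_,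
          fun s hs => hs.2, fun s hs => hs.2⟩
        ext s
        constructor
        · intro hs
          obtain ⟨r, hr, e⟩ := h s hs
          rcases List.mem_cons.1 hr with rfl | hr
          · exact Or.inl ⟨hs, e⟩
          · exact Or.inr ⟨hs, r, hr, e⟩
        · rintro (h | h)
          · exact h.1
          · exact h.1

theorem depSat_depx {σ : Type} {ar : σ → ℕ} {A : Type} (M : DepStr σ ar A) (T : Set (Fin 1 → A)) :
    DepSat M (Fin 1) (depx ar) T ↔ T.encard ≤ 1 := by
  rw [Set.encard_le_one_iff]
  constructor
  · intro h s t hs ht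
    funext i
    rw [Subsingleton.elim i 0]
    exact h s hs t ht (fun i => i.elim0)
  · intro h s hs t ht _
    rw [h s t hs ht]

theorem depSat_depxOr {σ : Type} {ar : σ → ℕ} {A : Type} (M : DepStr σ ar A) (n : ℕ) :
    ∀ T : Set (Fin 1 → A), DepSat M (Fin 1) (depxOr ar (n+1)) T ↔ T.encard ≤ (n + 1 : ℕ) := by
  induction n with
  | zero => intro T; simpa [depxOr, orListD] using depSat_depx M T
  | succ n ih =>
    intro T
    have e : depxOr ar (n+1+1) = .or (depx ar) (depxOr ar (n+1)) := rfl
    rw [e]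
    simp only [DepSat, ih, depSat_depx]
    constructor
    · rintro ⟨T1, T2, rfl, h1, h2⟩
      refine (Set.encard_union_le _ _).trans ((add_le_add h1 h2).trans ?_)
      push_cast
      rw [add_comm]
    · intro h
      rcases T.eq_empty_or_nonempty with rfl | ⟨t, ht⟩
      · exact ⟨∅, ∅, by simp, by simp, by simp⟩
      · refine ⟨{t}, T \ {t}, by simp [ht], by simp, ?_⟩
        rw [← Set.encard_sdiff_singleton_add_one ht] at h
        push_cast at h ⊢
        exact (ENat.add_le_add_iff_right (by simp)).1 h

theorem depSat_atMostK {σ : Type} {ar : σ → ℕ} {A : Type} (M : DepStr σ ar A) (k : ℕ) (hk : 2 ≤ k)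
    (T : Set (Fin 1 → A)) :
    DepSat M (Fin 1) (atMostK ar k) T ↔ T = ∅ ∨ ¬ (k : Cardinal) < Cardinal.mk A := by
  rw [atMostK, depSat_allIter, depSat_orEq]
  swap
  · intro h
    have : ((⟨0, by omega⟩, ⟨1, by omega⟩) : Fin (k+1) × Fin (k+1)) ∈
        (((List.finRange (k+1)).product (List.finRange (k+1))).filter (fun p => p.1 < p.2)) := by
      simp only [List.mem_filter, decide_eq_true_eq]
      exact ⟨by simp, Nat.zero_lt_one⟩
    rw [h] at this
    simp at this
  constructor
  · intro h
    by_contra! hc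
    obtain ⟨⟨t, ht⟩, hc⟩ := hc
    have h1 : Cardinal.mk (Fin (k+1)) ≤ Cardinal.mk A := by
      have := Order.succ_le_of_lt hc
      simpa using this
    obtain ⟨g⟩ := h1
    obtain ⟨s, hs1, hs2⟩ := exists_ext (k+1) t g
    obtain ⟨p, hp, e⟩ := h s (by rw [dupIter, Set.mem_ofPred_eq, hs1]; exact ht)
    rw [hs2, hs2] at e
    have hlt : p.1 < p.2 := by simpa using (List.mem_filter.1 hp).2
    exact hlt.ne (g.injective e)
  · rintro (rfl | hc) s hs
    · exact hs.elim
    · have hn : ¬ Function.Injective (fun i : Fin (k+1) => s (newVar (k+1) i)) := by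
        intro hi
        apply hc
        have := Cardinal.mk_le_of_injective hi
        refine lt_of_lt_of_le ?_ this
        simp only [Cardinal.mk_fin]
        exact_mod_cast Nat.lt_succ_self k
      simp only [Function.Injective] at hn
      push Not at hn
      obtain ⟨i, j, e, hij⟩ := hn
      rcases lt_or_gt_of_ne hij with h | h
      · exact ⟨(i, j), by simp [h], e⟩
      · exact ⟨(j, i), by simp [h], e.symm⟩

theorem depSat_psi12 {σ : Type} {ar : σ → ℕ} {A : Type} [Nonempty A] (M : DepStr σ ar A)
    (k : ℕ) (hk : 2 ≤ k) (φ : DepFormula σ ar Empty) (T : Set (Fin 1 → A)) :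
    DepSat M (Fin 1) (psi12 ar k φ) T ↔
      ¬ (k : Cardinal) < Cardinal.mk A ∨ DTrueIn M φ ∨ T.encard ≤ k := by
  obtain ⟨n, rfl⟩ : ∃ n, k = n + 1 := ⟨k - 1, by omega⟩
  simp only [psi12, DepSat, depSat_atMostK M _ hk, depSat_sentence, depSat_depxOr]
  constructor
  · rintro ⟨_, T3, rfl, ⟨T1, T2, rfl, h1, h2⟩, h3⟩
    rcases h1 with rfl | h1
    · rcases h2 with rfl | h2
      · right; right; simpa using h3
      · exact Or.inr (Or.inl h2)
    · exact Or.inl h1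
  · rintro (h | h | h)
    · exact ⟨T, ∅, by simp, ⟨T, ∅, by simp, Or.inr h, Or.inl rfl⟩, by simp⟩
    · exact ⟨T, ∅, by simp, ⟨∅, T, by simp, Or.inl rfl, Or.inr h⟩, by simp⟩
    · exact ⟨∅, T, by simp, ⟨∅, ∅, by simp, Or.inl rfl, Or.inl rfl⟩, h⟩

/-- Fix `k ≥ 2` and let `τ` consist of one binary relation symbol.
A dependence-logic sentence `φ` is true in every `τ`-structure of cardinality `> k`
iff `ψ = (θ ∨ φ) ∨ ⋁_{i=1}^{k} dep(x)` is `k`-coherent, where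
`θ = ∀x₁…∀x_{k+1} ⋁_{i<j} xᵢ = xⱼ`. -/
theorem stmt12 (k : ℕ) (hk : 2 ≤ k) (φ : DepFormula Unit (fun _ => 2) Empty) :
    (∀ (A : Type) (M : DepStr Unit (fun _ => 2) A),
        (k : Cardinal) < Cardinal.mk A → DTrueIn M φ) ↔
      KCoherent k (psi12 (fun _ => 2) k φ) := by
  constructor
  · intro h A _ M T
    have key : ∀ S : Set (Fin 1 → A), DepSat M (Fin 1) (psi12 (fun _ => 2) k φ) S := by
      intro S
      rw [depSat_psi12 M k hk]
      by_cases hc : (k : Cardinal) < Cardinal.mk A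
      · exact Or.inr (Or.inl (h A M hc))
      · exact Or.inl hc
    exact ⟨fun _ S _ _ _ => key S, fun _ => key T⟩
  · intro h A M hc
    have hne : Nonempty A := by
      rw [← Cardinal.mk_ne_zero_iff]
      exact (lt_of_le_of_lt zero_le hc).ne'
    have h1 := (h A M Set.univ).2 (fun S _ hf hS => by
      rw [depSat_psi12 M k hk]
      right; right
      rw [← hf.cast_ncard_eq]
      exact_mod_cast hS)
    rw [depSat_psi12 M k hk] at h1
    rcases h1 with h1 | h1 | h1
    · exact absurd hc h1
    · exact h1
    · exfalso
      have h2 : Cardinal.mk (Fin (k+1)) ≤ Cardinal.mk A := by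
        have := Order.succ_le_of_lt hc
        simpa using this
      obtain ⟨g⟩ := h2
      have hi : Function.Injective (fun (i : Fin (k+1)) (_ : Fin 1) => g i) :=
        fun i j e => g.injective (congrFun e 0)
      have h3 := (Set.encard_le_encard (Set.subset_univ
        ((fun (i : Fin (k+1)) (_ : Fin 1) => g i) '' Set.univ))).trans h1
      rw [hi.encard_image, Set.encard_univ] at h3
      simp only [ENat.card_eq_coe_fintype_card, Fintype.card_fin] at h3
      have : k + 1 ≤ k := by exact_mod_cast h3
      omega
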